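/- Let A be a primitive left-stochastic N×N real matrix with Perron eigenvector p and P = diag(p), and assume A satisfies the local balance condition P Aᵀ = A P. Let W be any real N×M matrix, whose rows w_1ᵀ, …, w_Nᵀ are regarded as the blocks of a block vector. Then (P − A P)·W = 0 (the zero N×M matrix) if and only if all rows of W are equal: w_1 = w_2 = ⋯ = w_N. -/

import Mathlib

open Matrix BigOperators

namespace Matrix

/-- A vector fixed by a matrix is fixed by all its powers. -/
lemma vecMul_pow_eq_self {n R : Type*} [Fintype n] [DecidableEq n] [Semiring R]
    {A : Matrix n n R} {v : n → R} (h : v ᵥ* A = v) (k : ℕ) : v ᵥ* A ^ k = v := by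
  induction k with
  | zero => simp
  | succ k ih => rw [pow_succ, ← vecMul_vecMul, ih, h]

/-- Maximum principle: a left-fixed vector of a positive left-stochastic matrix is constant. -/
lemma eq_of_vecMul_eq_self_of_pos {n : Type*} [Fintype n] {B : Matrix n n ℝ} {v : n → ℝ}
    (hpos : ∀ i j, 0 < B i j) (hcol : 1 ᵥ* B = 1) (hv : v ᵥ* B = v) (k l : n) :
    v k = v l := by
  have : Nonempty n := ⟨k⟩
  obtain ⟨m, hm⟩ := Finite.exists_max v
  have hsum : ∑ i, (v m - v i) * B i m = 0 := by
    have hc : ∑ i, B i m = 1 := by simpa [vecMul, dotProduct] using congrFun hcol m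
    have hf : ∑ i, v i * B i m = v m := congrFun hv m
    simp only [sub_mul, Finset.sum_sub_distrib, ← Finset.mul_sum, hc, hf, mul_one, sub_self]
  have hnonneg : ∀ i ∈ Finset.univ, 0 ≤ (v m - v i) * B i m := fun i _ =>
    mul_nonneg (sub_nonneg.2 (hm i)) (hpos i m).le
  have heq (i : n) : v m = v i := by
    have := (Finset.sum_eq_zero_iff_of_nonneg hnonneg).1 hsum i (Finset.mem_univ i)
    exact sub_eq_zero.1 ((mul_eq_zero.1 this).resolve_right (hpos i m).ne')
  rw [← heq k, heq l]

end Matrix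

/-- Block (Kronecker) version of the null-space characterization:
for any `N × M` matrix `W` whose rows are the blocks of a block vector,
`(P - A P) W = 0` iff all rows of `W` coincide. -/
theorem stmt4 {N M : ℕ} (A : Matrix (Fin N) (Fin N) ℝ)
    (hA_nonneg : ∀ i j, 0 ≤ A i j)
    (hA_col : ∀ k, ∑ l, A l k = 1)
    (hA_prim : ∃ n : ℕ, 1 ≤ n ∧ ∀ i j, 0 < (A ^ n) i j)
    (p : Fin N → ℝ)
    (hp_pos : ∀ k, 0 < p k) (hp_sum : ∑ k, p k = 1)
    (hp_eig : A *ᵥ p = p)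
    (hbal : Matrix.diagonal p * Aᵀ = A * Matrix.diagonal p)
    (W : Matrix (Fin N) (Fin M) ℝ) :
    (Matrix.diagonal p - A * Matrix.diagonal p) * W = 0 ↔
    ∀ k l : Fin N, W k = W l := by
  have hcol : 1 ᵥ* A = 1 := by
    ext k
    simpa [vecMul, dotProduct] using hA_col k
  have hentry (k : Fin N) (j : Fin M) :
      ((Matrix.diagonal p - A * Matrix.diagonal p) * W) k j
        = p k * (W k j - ((fun l => W l j) ᵥ* A) k) := by
    have hfactor : (Matrix.diagonal p - A * Matrix.diagonal p) * W
        = Matrix.diagonal p * (W - Aᵀ * W) := by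
      rw [← hbal, Matrix.sub_mul, Matrix.mul_sub, Matrix.mul_assoc]
    rw [hfactor, Matrix.diagonal_mul, Matrix.sub_apply, Matrix.mul_apply]
    simp only [vecMul, dotProduct, Matrix.transpose_apply, mul_comm]
  constructor
  · intro h k l
    obtain ⟨n, -, hn⟩ := hA_prim
    ext j
    refine eq_of_vecMul_eq_self_of_pos (v := fun i => W i j) hn (vecMul_pow_eq_self hcol n)
      (vecMul_pow_eq_self ?_ n) k l
    ext i
    have hi := hentry i j
    rw [h, Matrix.zero_apply, eq_comm, mul_eq_zero] at hi
    exact (sub_eq_zero.1 (hi.resolve_left (hp_pos i).ne')).symm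
  · intro h
    ext k j
    have hfix : ((fun l => W l j) ᵥ* A) k = W k j := by
      simp only [vecMul, dotProduct, h _ k, ← Finset.mul_sum, hA_col, mul_one]
    rw [hentry, hfix, sub_self, mul_zero, Matrix.zero_apply]
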